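/- Almost surely, Π_{X,X+2}(x) ~ x/(log x)^2 as x → ∞; that is, for ℙ-almost every realization α of the Hawkins random sieve, the number of m ≤ x with both m ∈ α and m + 2 ∈ α is asymptotic to x/(log x)^2. -/

import Mathlib

open MeasureTheory Filter Finset Asymptotics
open scoped Classical

/-- `y_m(α) = ∏_{j ∈ α, j < m} (1 - 1/j)` (empty product = 1). -/
noncomputable def hawkinsY (A : Set ℕ) (m : ℕ) : ℝ :=
  ∏ j ∈ Finset.range m, if j ∈ A then 1 - 1 / (j : ℝ) else 1

/-- The σ-algebra generated by the events `{j ∈ α}` for `2 ≤ j < m`. -/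
def sieveSigma {Ω : Type*} (α : Ω → Set ℕ) (m : ℕ) : MeasurableSpace Ω :=
  MeasurableSpace.generateFrom {s | ∃ j : ℕ, 2 ≤ j ∧ j < m ∧ s = {ω | j ∈ α ω}}

/-- Wunderlich's model of the Hawkins random sieve: a probability space `(Ω, μ)` with a
random subset `α` of `{2,3,4,…}` such that `μ(2 ∈ α) = 1` and, for every `m ≥ 2`, the
conditional probability of `{m ∈ α}` given the σ-algebra generated by the events
`{j ∈ α}`, `2 ≤ j < m`, equals `y_m(α)`. -/
structure IsHawkinsSieve {Ω : Type*} [MeasurableSpace Ω] (μ : Measure Ω)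
    (α : Ω → Set ℕ) : Prop where
  isProb : IsProbabilityMeasure μ
  meas : ∀ n : ℕ, MeasurableSet {ω | n ∈ α ω}
  mem_ge_two : ∀ ω, ∀ n ∈ α ω, 2 ≤ n
  two_mem : μ {ω | 2 ∈ α ω} = 1
  condExp_mem : ∀ m : ℕ, 2 ≤ m →
    μ[Set.indicator {ω | m ∈ α ω} (fun _ => (1 : ℝ)) | sieveSigma α m]
      =ᵐ[μ] fun ω => hawkinsY (α ω) m

/-- `M_k = 1 + ∑_{j=1}^{k-2} 1/j` (so `M_2 = 1`). -/
noncomputable def Mharm (k : ℕ) : ℝ := 1 + ∑ j ∈ Finset.Icc 1 (k - 2), 1 / (j : ℝ)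

/-- `Π_{X,X+k}(x; α)`: the number of `m ≤ x` with `m ∈ α` and `m + k ∈ α`. -/
noncomputable def piTwin (A : Set ℕ) (k x : ℕ) : ℕ :=
  ((Finset.range (x + 1)).filter fun m => m ∈ A ∧ m + k ∈ A).card

/-- A sum of bounded martingale differences with summable second moments converges almost
surely. -/
theorem ae_tendsto_sum_of_martingale_difference {Ω : Type*} {m0 : MeasurableSpace Ω}
    {μ : Measure Ω} [IsProbabilityMeasure μ] (ℱ : Filtration ℕ m0) (D : ℕ → Ω → ℝ)
    (hD : ∀ n, StronglyMeasurable[ℱ (n + 1)] (D n)) (C : ℕ → ℝ) (hC : ∀ n ω, |D n ω| ≤ C n)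
    (h0 : ∀ n, μ[D n | ℱ n] =ᵐ[μ] 0) (hs : Summable fun n => ∫ ω, D n ω ^ 2 ∂μ) :
    ∀ᵐ ω ∂μ, ∃ l, Tendsto (fun n => ∑ i ∈ range n, D i ω) atTop (nhds l) := by
  set S : ℕ → Ω → ℝ := fun n ω => ∑ i ∈ range n, D i ω with hS
  have hSm : ∀ n, StronglyMeasurable[ℱ n] (S n) := fun n =>
    Finset.stronglyMeasurable_fun_sum _ fun i hi =>
      (hD i).mono (ℱ.mono (Nat.succ_le_of_lt (mem_range.1 hi)))
  have hSb : ∀ n ω, |S n ω| ≤ ∑ i ∈ range n, C i := fun n ω =>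
    (Finset.abs_sum_le_sum_abs _ _).trans (Finset.sum_le_sum fun i _ => hC i ω)
  have hint : ∀ (f : Ω → ℝ) (c : ℝ), StronglyMeasurable f → (∀ ω, |f ω| ≤ c) →
      Integrable f μ := fun f c hf hc =>
    Integrable.of_bound hf.aestronglyMeasurable c (ae_of_all _ hc)
  have hDm : ∀ n, StronglyMeasurable (D n) := fun n => (hD n).mono (ℱ.le _)
  have hSm' : ∀ n, StronglyMeasurable (S n) := fun n => (hSm n).mono (ℱ.le _)
  have hDi : ∀ n, Integrable (D n) μ := fun n => hint _ _ (hDm n) (hC n)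
  have hSi : ∀ n, Integrable (S n) μ := fun n => hint _ _ (hSm' n) (hSb n)
  have hD2 : ∀ n, Integrable (fun ω => D n ω ^ 2) μ := fun n =>
    hint _ (C n ^ 2) ((hDm n).pow 2) fun ω => by
      rw [abs_pow]; exact pow_le_pow_left₀ (abs_nonneg _) (hC n ω) 2
  have hS2 : ∀ n, Integrable (fun ω => S n ω ^ 2) μ := fun n =>
    hint _ ((∑ i ∈ range n, C i) ^ 2) ((hSm' n).pow 2) fun ω => by
      rw [abs_pow]; exact pow_le_pow_left₀ (abs_nonneg _) (hSb n ω) 2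
  have hSD : ∀ n, Integrable (S n * D n) μ := fun n =>
    (hDi n).bdd_mul (hSm' n).aestronglyMeasurable (ae_of_all _ (hSb n))
  have hcross : ∀ n, ∫ ω, S n ω * D n ω ∂μ = 0 := fun n => by
    have h1 := condExp_mul_of_stronglyMeasurable_left (hSm n) (hSD n) (hDi n)
    have h2 : μ[S n * D n | ℱ n] =ᵐ[μ] 0 := by
      filter_upwards [h1, h0 n] with ω h h'
      rw [h, Pi.mul_apply, h']; simp
    calc ∫ ω, S n ω * D n ω ∂μ = ∫ ω, (μ[S n * D n | ℱ n]) ω ∂μ :=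
          (integral_condExp (ℱ.le n)).symm
      _ = 0 := by rw [integral_congr_ae h2]; simp
  have hsq : ∀ n, ∫ ω, S n ω ^ 2 ∂μ = ∑ i ∈ range n, ∫ ω, D i ω ^ 2 ∂μ := by
    intro n
    induction n with
    | zero => simp [hS]
    | succ n ih =>
      have : ∀ ω, S (n + 1) ω ^ 2 = S n ω ^ 2 + 2 * (S n ω * D n ω) + D n ω ^ 2 := fun ω => by
        simp only [hS, Finset.sum_range_succ]; ring
      have hSD2 : Integrable (fun ω => 2 * (S n ω * D n ω)) μ := (hSD n).const_mul 2
      have hadd : Integrable (fun ω => S n ω ^ 2 + 2 * (S n ω * D n ω)) μ := (hS2 n).add hSD2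
      simp_rw [this]
      rw [integral_add hadd (hD2 n), integral_add (hS2 n) hSD2, integral_const_mul, hcross n, ih,
        Finset.sum_range_succ]
      ring
  have hmart : Martingale S ℱ μ := by
    refine martingale_of_condExp_sub_eq_zero_nat hSm hSi fun n => ?_
    have : S (n + 1) - S n = D n := by
      ext ω; simp [hS, Finset.sum_range_succ]
    rw [this]; exact h0 n
  set R : ℝ := 1 + ∑' n, ∫ ω, D n ω ^ 2 ∂μ with hR
  have hbdd : ∀ n, eLpNorm (S n) 1 μ ≤ (R.toNNReal : ENNReal) := fun n => by
    rw [eLpNorm_one_eq_lintegral_enorm, ← ofReal_integral_norm_eq_lintegral_enorm (hSi n)]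
    refine ENNReal.ofReal_le_ofReal ?_
    calc ∫ ω, ‖S n ω‖ ∂μ ≤ ∫ ω, (1 + S n ω ^ 2) ∂μ := by
          refine integral_mono (hSi n).norm ((integrable_const _).add (hS2 n)) fun ω => ?_
          simp only [Real.norm_eq_abs]
          nlinarith [sq_nonneg (|S n ω| - 1), sq_abs (S n ω), abs_nonneg (S n ω)]
      _ = 1 + ∑ i ∈ range n, ∫ ω, D i ω ^ 2 ∂μ := by
          rw [integral_add (integrable_const _) (hS2 n), hsq n]; simp
      _ ≤ R := by
          rw [hR]; gcongr
          exact hs.sum_le_tsum _ fun i _ => integral_nonneg fun ω => sq_nonneg _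
  filter_upwards [hmart.submartingale.ae_tendsto_limitProcess hbdd] with ω hω
  exact ⟨_, hω⟩

/-- **Kronecker's lemma**. -/
theorem isLittleO_sum_range_of_tendsto_sum_div {b d : ℕ → ℝ} (hb : Monotone b)
    (hpos : ∀ n, 0 < b n) (hb' : Tendsto b atTop atTop) {l : ℝ}
    (h : Tendsto (fun n => ∑ i ∈ range n, d i / b i) atTop (nhds l)) :
    (fun n => ∑ i ∈ range n, d i) =o[atTop] b := by
  set T : ℕ → ℝ := fun n => ∑ i ∈ range n, d i / b i with hT
  have key : ∀ n, ∑ i ∈ range n, d i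
      = b n * (T n - l) - ∑ i ∈ range n, (b (i + 1) - b i) * (T (i + 1) - l) + l * b 0 := by
    intro n
    induction n with
    | zero => simp [hT]; ring
    | succ n ih =>
      have : T (n + 1) = T n + d n / b n := Finset.sum_range_succ _ _
      have hd : d n = b n * (T (n + 1) - T n) := by
        rw [this]; field_simp [(hpos n).ne']; ring
      rw [Finset.sum_range_succ, ih, Finset.sum_range_succ, hd]
      ring
  have hT0 : (fun n => T n - l) =o[atTop] (fun _ => (1 : ℝ)) := by
    rw [isLittleO_one_iff]; simpa using h.sub_const l
  have hconst : ∀ c : ℝ, (fun _ : ℕ => c) =o[atTop] b := fun c =>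
    isLittleO_const_left.2 (Or.inr (tendsto_norm_atTop_atTop.comp hb'))
  have hsumb : ∀ n, ∑ i ∈ range n, (b (i + 1) - b i) = b n - b 0 := fun n =>
    Finset.sum_range_sub b n
  have h1 : (fun n => b n * (T n - l)) =o[atTop] b := by
    simpa using (isBigO_refl b atTop).mul_isLittleO hT0
  have h2 : (fun n => ∑ i ∈ range n, (b (i + 1) - b i) * (T (i + 1) - l)) =o[atTop] b := by
    have hl : (fun i => (b (i + 1) - b i) * (T (i + 1) - l)) =o[atTop]
        fun i => b (i + 1) - b i := by
      simpa using (isBigO_refl (fun i => b (i + 1) - b i) atTop).mul_isLittleO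
        (hT0.comp_tendsto (tendsto_add_atTop_nat 1))
    have := hl.sum_range (fun i => sub_nonneg.2 (hb (Nat.le_succ i))) (by
      simp_rw [hsumb]; exact tendsto_atTop_add_const_right _ _ hb')
    refine this.trans_isBigO ?_
    simp_rw [hsumb]
    exact (isBigO_refl b atTop).sub (hconst _).isBigO
  refine IsLittleO.congr_left ((h1.sub h2).add (hconst (l * b 0))) fun n => (key n).symm

theorem tendsto_log_natCast_atTop : Tendsto (fun n : ℕ => Real.log n) atTop atTop :=
  Real.tendsto_log_atTop.comp tendsto_natCast_atTop_atTop

theorem one_div_natCast_isLittleO_one_div_log_sq :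
    (fun n : ℕ => 1 / (n : ℝ)) =o[atTop] fun n : ℕ => 1 / Real.log n ^ 2 := by
  have h : (fun x : ℝ => Real.log x ^ (2 : ℝ)) =o[atTop] fun x => x ^ (1 : ℝ) :=
    isLittleO_log_rpow_rpow_atTop 2 one_pos
  have h' := h.comp_tendsto (tendsto_natCast_atTop_atTop (R := ℝ))
  simp only [Function.comp_def, Real.rpow_one, Real.rpow_two] at h'
  simp only [one_div]
  refine h'.inv_rev ?_
  filter_upwards [eventually_ge_atTop 2] with n hn h0
  have := Real.log_pos (show (1 : ℝ) < n by exact_mod_cast hn)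
  exact absurd h0 (by positivity)

theorem tendsto_sum_one_div_log_sq :
    Tendsto (fun n => ∑ k ∈ range n, 1 / Real.log (k : ℝ) ^ 2) atTop atTop := by
  rw [← not_summable_iff_tendsto_nat_atTop_of_nonneg (fun n => by positivity)]
  intro h
  exact Real.not_summable_one_div_natCast
    (summable_of_isBigO_nat h one_div_natCast_isLittleO_one_div_log_sq.isBigO)

theorem div_log_sq_isEquivalent_sum :
    (fun n : ℕ => (n : ℝ) / Real.log n ^ 2) ~[atTop]
      fun n => ∑ k ∈ range n, 1 / Real.log (k : ℝ) ^ 2 := by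
  have h : (fun n : ℕ => ((n + 1 : ℕ) : ℝ) / Real.log (n + 1 : ℕ) ^ 2 - n / Real.log n ^ 2
      - 1 / Real.log n ^ 2) =o[atTop] fun n : ℕ => 1 / Real.log n ^ 2 := by
    have h4 : (fun n : ℕ => 4 / Real.log (n + 1 : ℕ)) =o[atTop] fun _ => (1 : ℝ) := by
      rw [isLittleO_one_iff]
      exact (tendsto_log_natCast_atTop.comp (tendsto_add_atTop_nat 1)).const_div_atTop 4
    have h5 : (fun n : ℕ => 4 / Real.log (n + 1 : ℕ) * (1 / Real.log n ^ 2)) =o[atTop]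
        fun n : ℕ => 1 / Real.log n ^ 2 := by
      simpa only [one_mul] using h4.mul_isBigO (isBigO_refl (fun n : ℕ => 1 / Real.log n ^ 2) atTop)
    refine IsBigO.trans_isLittleO (IsBigO.of_bound 1 ?_) h5
    filter_upwards [eventually_ge_atTop 2] with n hn
    have hn' : (2 : ℝ) ≤ n := by exact_mod_cast hn
    have ha : 0 < Real.log n := Real.log_pos (by linarith)
    have hab : Real.log n ≤ Real.log (n + 1 : ℕ) :=
      Real.log_le_log (by linarith) (by push_cast; linarith)
    have hd : n * (Real.log (n + 1 : ℕ) - Real.log n) ≤ 1 := by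
      rw [← Real.log_div (by positivity) (by positivity)]
      have := Real.log_le_sub_one_of_pos (show (0 : ℝ) < (n + 1 : ℕ) / n by positivity)
      calc (n : ℝ) * Real.log ((n + 1 : ℕ) / n) ≤ n * ((n + 1 : ℕ) / n - 1) := by gcongr
        _ = 1 := by push_cast; field_simp; ring
    push_cast at *
    set a := Real.log n
    set b := Real.log (n + 1 : ℝ)
    have hb : 0 < b := by linarith
    have e : ((n : ℝ) + 1) / b ^ 2 - n / a ^ 2 - 1 / a ^ 2
        = -(((n : ℝ) + 1) * (b - a) * (b + a) / b ^ 2 * (1 / a ^ 2)) := by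
      field_simp; ring
    rw [e, norm_neg, one_mul, norm_mul, norm_mul]
    gcongr
    rw [Real.norm_of_nonneg (by have := sub_nonneg.2 hab; positivity),
      Real.norm_of_nonneg (by positivity), div_le_div_iff₀ (by positivity) hb]
    have h2 : ((n : ℝ) + 1) * (b - a) ≤ 2 := by nlinarith
    have h3 : ((n : ℝ) + 1) * (b - a) * (b + a) ≤ 2 * (2 * b) := by
      apply mul_le_mul h2 <;> linarith
    nlinarith
  have hsum := h.sum_range (fun n => by positivity) tendsto_sum_one_div_log_sq
  refine hsum.congr_left fun n => ?_
  rw [Finset.sum_sub_distrib, Finset.sum_range_sub (fun n : ℕ => (n : ℝ) / Real.log n ^ 2)]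
  simp

theorem rpow_isLittleO_sum_one_div_log_sq :
    (fun n : ℕ => ((n : ℝ) + 1) ^ (3 / 4 : ℝ)) =o[atTop]
      fun n => ∑ k ∈ range n, 1 / Real.log (k : ℝ) ^ 2 := by
  refine IsLittleO.trans_isBigO ?_ div_log_sq_isEquivalent_sum.isBigO
  have h : (fun x : ℝ => Real.log x ^ (2 : ℝ)) =o[atTop] fun x => x ^ (1 / 4 : ℝ) :=
    isLittleO_log_rpow_rpow_atTop 2 (by norm_num)
  have h' := h.comp_tendsto (tendsto_natCast_atTop_atTop (R := ℝ))
  simp only [Function.comp_def, Real.rpow_two] at h'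
  have h1 : (fun n : ℕ => ((n : ℝ) + 1) ^ (3 / 4 : ℝ)) =O[atTop]
      fun n : ℕ => (n : ℝ) ^ (3 / 4 : ℝ) := by
    refine IsBigO.of_bound (2 ^ (3 / 4 : ℝ)) ?_
    filter_upwards [eventually_ge_atTop 1] with n hn
    have hn' : (1 : ℝ) ≤ n := by exact_mod_cast hn
    rw [Real.norm_of_nonneg (by positivity), Real.norm_of_nonneg (by positivity),
      ← Real.mul_rpow (by norm_num) (by positivity)]
    gcongr
    linarith
  refine h1.trans_isLittleO ?_
  have h2 : (fun n : ℕ => (n : ℝ) ^ (3 / 4 : ℝ) * Real.log n ^ 2 * (1 / Real.log n ^ 2)) =o[atTop]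
      fun n : ℕ => (n : ℝ) ^ (3 / 4 : ℝ) * (n : ℝ) ^ (1 / 4 : ℝ) * (1 / Real.log n ^ 2) :=
    ((isBigO_refl _ _).mul_isLittleO h').mul_isBigO (isBigO_refl _ _)
  refine h2.congr' ?_ ?_
  · filter_upwards [eventually_ge_atTop 2] with n hn
    have := Real.log_pos (show (1 : ℝ) < n by exact_mod_cast hn)
    field_simp
  · filter_upwards [eventually_ge_atTop 2] with n hn
    have : (0 : ℝ) < n := by exact_mod_cast (by omega : 0 < n)
    rw [← Real.rpow_add this]
    norm_num
    rfl

/-- The indicator function of a set of natural numbers, with real values. -/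
noncomputable def memInd (A : Set ℕ) (n : ℕ) : ℝ := if n ∈ A then 1 else 0

theorem memInd_nonneg (A : Set ℕ) (n : ℕ) : 0 ≤ memInd A n := by
  unfold memInd; split_ifs <;> norm_num

theorem memInd_le_one (A : Set ℕ) (n : ℕ) : memInd A n ≤ 1 := by
  unfold memInd; split_ifs <;> norm_num

theorem memInd_sq (A : Set ℕ) (n : ℕ) : memInd A n ^ 2 = memInd A n := by
  unfold memInd; split_ifs <;> norm_num

theorem memInd_of_lt_two {A : Set ℕ} (hA : ∀ n ∈ A, 2 ≤ n) {n : ℕ} (hn : n < 2) :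
    memInd A n = 0 :=
  if_neg fun h => absurd (hA n h) (by omega)

theorem hawkinsY_succ (A : Set ℕ) (n : ℕ) :
    hawkinsY A (n + 1) = hawkinsY A n * (1 - memInd A n / n) := by
  unfold hawkinsY memInd
  rw [Finset.prod_range_succ]
  split_ifs <;> simp

theorem hawkinsY_two {A : Set ℕ} (hA : ∀ n ∈ A, 2 ≤ n) : hawkinsY A 2 = 1 := by
  rw [hawkinsY_succ, hawkinsY_succ, memInd_of_lt_two hA one_lt_two,
    memInd_of_lt_two hA zero_lt_two]
  simp [hawkinsY]

theorem one_le_mul_hawkinsY {A : Set ℕ} (hA : ∀ n ∈ A, 2 ≤ n) (k : ℕ) :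
    1 ≤ ((k : ℝ) + 1) * hawkinsY A (k + 2) := by
  induction k with
  | zero => simp [hawkinsY_two hA]
  | succ k ih =>
    rw [show k + 1 + 2 = (k + 2) + 1 by ring, hawkinsY_succ]
    have hY : 0 < hawkinsY A (k + 2) := by
      by_contra! h0
      nlinarith [(Nat.cast_nonneg k : (0 : ℝ) ≤ k)]
    have hX : memInd A (k + 2) / ((k + 2 : ℕ) : ℝ) ≤ 1 / ((k : ℝ) + 2) := by
      push_cast; gcongr; exact memInd_le_one _ _
    calc 1 ≤ ((k : ℝ) + 1) * hawkinsY A (k + 2) := ih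
      _ = ((k : ℝ) + 2) * (hawkinsY A (k + 2) * (1 - 1 / ((k : ℝ) + 2))) := by
        field_simp; ring
      _ ≤ ((k + 1 : ℕ) + 1 : ℝ) * (hawkinsY A (k + 2) *
          (1 - memInd A (k + 2) / ((k + 2 : ℕ) : ℝ))) := by
        push_cast at hX ⊢
        rw [show (k : ℝ) + 1 + 1 = k + 2 by ring]
        gcongr

theorem hawkinsY_nonneg {A : Set ℕ} (hA : ∀ n ∈ A, 2 ≤ n) (n : ℕ) : 0 ≤ hawkinsY A n := by
  refine Finset.prod_nonneg fun j _ => ?_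
  split_ifs with h
  · have : (1 : ℝ) ≤ j := by exact_mod_cast (by have := hA j h; omega : 1 ≤ j)
    rw [sub_nonneg, div_le_one (by linarith)]
    exact this
  · exact zero_le_one

theorem hawkinsY_pos {A : Set ℕ} (hA : ∀ n ∈ A, 2 ≤ n) (k : ℕ) : 0 < hawkinsY A (k + 2) := by
  refine (hawkinsY_nonneg hA _).lt_of_ne fun h => ?_
  have := one_le_mul_hawkinsY hA k
  rw [← h] at this
  norm_num at this

theorem hawkinsY_le_one {A : Set ℕ} (hA : ∀ n ∈ A, 2 ≤ n) (n : ℕ) : hawkinsY A n ≤ 1 := by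
  induction n with
  | zero => simp [hawkinsY]
  | succ n ih =>
    rw [hawkinsY_succ]
    have := hawkinsY_nonneg hA n
    have : 0 ≤ memInd A n / n := div_nonneg (memInd_nonneg _ _) (Nat.cast_nonneg _)
    nlinarith

theorem abs_hawkinsY_succ_sub_le {A : Set ℕ} (hA : ∀ n ∈ A, 2 ≤ n) (n : ℕ) :
    |hawkinsY A (n + 1) - hawkinsY A n| ≤ 1 / n := by
  have e : hawkinsY A (n + 1) - hawkinsY A n = -(hawkinsY A n * memInd A n / n) := by
    rw [hawkinsY_succ]; ring
  have h0 := hawkinsY_nonneg hA n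
  have h1 := memInd_nonneg A n
  rw [e, abs_neg, abs_of_nonneg (by positivity)]
  gcongr
  exact mul_le_one₀ (hawkinsY_le_one hA n) h1 (memInd_le_one A n)

theorem inv_hawkinsY_le {A : Set ℕ} (hA : ∀ n ∈ A, 2 ≤ n) (k : ℕ) :
    (hawkinsY A (k + 2))⁻¹ ≤ (k : ℝ) + 1 := by
  rw [inv_le_iff_one_le_mul₀ (hawkinsY_pos hA k)]
  exact one_le_mul_hawkinsY hA k

/-- The reciprocal of `hawkinsY` grows by `1 / (k + 1)` plus a fluctuation of conditional mean
zero. -/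
theorem inv_hawkinsY_succ {A : Set ℕ} (hA : ∀ n ∈ A, 2 ≤ n) (k : ℕ) :
    (hawkinsY A (k + 1 + 2))⁻¹ = (hawkinsY A (k + 2))⁻¹ + 1 / ((k : ℝ) + 1)
      + (hawkinsY A (k + 2))⁻¹ / ((k : ℝ) + 1)
        * (memInd A (k + 2) - hawkinsY A (k + 2)) := by
  have hY := hawkinsY_pos hA k
  rw [show k + 1 + 2 = (k + 2) + 1 by ring, hawkinsY_succ]
  set Y := hawkinsY A (k + 2)
  have e : ((k : ℝ) + 2) ≠ 0 := by positivity
  have e' : (1 : ℝ) - 1 / (k + 2) = (k + 1) / (k + 2) := by field_simp; ring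
  unfold memInd
  split_ifs
  · push_cast
    rw [e']
    field_simp
    ring
  · simp only [zero_div, sub_zero, mul_one]
    field_simp
    ring

theorem sieveSigma_mono {Ω : Type*} (α : Ω → Set ℕ) : Monotone (sieveSigma α) := fun _ _ hmn =>
  MeasurableSpace.generateFrom_mono fun _ ⟨j, h2, hj, hs⟩ => ⟨j, h2, hj.trans_le hmn, hs⟩

section HawkinsSieve

variable {Ω : Type*} [MeasurableSpace Ω] {μ : Measure Ω} {α : Ω → Set ℕ}

theorem IsHawkinsSieve.sieveSigma_le (h : IsHawkinsSieve μ α) (m : ℕ) :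
    sieveSigma α m ≤ ‹MeasurableSpace Ω› := by
  refine MeasurableSpace.generateFrom_le ?_
  rintro s ⟨j, -, -, rfl⟩
  exact h.meas j

/-- The filtration of a Hawkins sieve, indexed so that `k` knows `α` below `k + 2`. -/
def IsHawkinsSieve.filtration (h : IsHawkinsSieve μ α) : Filtration ℕ ‹MeasurableSpace Ω› where
  seq k := sieveSigma α (k + 2)
  mono' := fun _ _ hij => sieveSigma_mono α (by omega)
  le' _ := h.sieveSigma_le _

theorem IsHawkinsSieve.measurable_memInd (h : IsHawkinsSieve μ α) {j m : ℕ} (hj : j < m) :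
    Measurable[sieveSigma α m] fun ω => memInd (α ω) j := by
  by_cases h2 : 2 ≤ j
  · exact Measurable.ite (MeasurableSpace.measurableSet_generateFrom ⟨j, h2, hj, rfl⟩)
      measurable_const measurable_const
  · have : (fun ω => memInd (α ω) j) = fun _ => (0 : ℝ) :=
      funext fun ω => memInd_of_lt_two (h.mem_ge_two ω) (by omega)
    rw [this]
    exact measurable_const

theorem IsHawkinsSieve.measurable_hawkinsY (h : IsHawkinsSieve μ α) (m : ℕ) :
    Measurable[sieveSigma α m] fun ω => hawkinsY (α ω) m := by
  have e : ∀ n, ∀ ω, hawkinsY (α ω) n = ∏ j ∈ range n, (1 - memInd (α ω) j / j) := by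
    intro n ω
    induction n with
    | zero => simp [hawkinsY]
    | succ n ih => rw [hawkinsY_succ, ih, Finset.prod_range_succ]
  simp_rw [e m]
  exact Finset.measurable_fun_prod _ fun j hj =>
    measurable_const.sub ((h.measurable_memInd (mem_range.1 hj)).div_const _)

theorem IsHawkinsSieve.abs_memInd_sub_hawkinsY_le (h : IsHawkinsSieve μ α) (n m : ℕ) (ω : Ω) :
    |memInd (α ω) n - hawkinsY (α ω) m| ≤ 1 := by
  have h1 := memInd_nonneg (α ω) n
  have h2 := memInd_le_one (α ω) n
  have h3 := hawkinsY_nonneg (h.mem_ge_two ω) m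
  have h4 := hawkinsY_le_one (h.mem_ge_two ω) m
  rw [abs_le]
  constructor <;> linarith

section Difference

variable {G : Ω → ℝ} {C : ℝ} {k : ℕ}

theorem IsHawkinsSieve.measurable_difference (h : IsHawkinsSieve μ α)
    (hG : Measurable[sieveSigma α (k + 2)] G) :
    Measurable[sieveSigma α (k + 1 + 2)]
      fun ω => G ω * (memInd (α ω) (k + 2) - hawkinsY (α ω) (k + 2)) := by
  have hle : sieveSigma α (k + 2) ≤ sieveSigma α (k + 1 + 2) := sieveSigma_mono α (by omega)
  exact (hG.mono hle le_rfl).mul ((h.measurable_memInd (by omega)).sub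
    ((h.measurable_hawkinsY (k + 2)).mono hle le_rfl))

theorem IsHawkinsSieve.abs_difference_le (h : IsHawkinsSieve μ α) (hC : ∀ ω, |G ω| ≤ C) (ω : Ω) :
    |G ω * (memInd (α ω) (k + 2) - hawkinsY (α ω) (k + 2))| ≤ C := by
  rw [abs_mul, ← mul_one C]
  exact mul_le_mul (hC ω) (h.abs_memInd_sub_hawkinsY_le _ _ ω) (abs_nonneg _)
    ((abs_nonneg _).trans (hC ω))

theorem IsHawkinsSieve.condExp_difference (h : IsHawkinsSieve μ α)
    (hG : Measurable[sieveSigma α (k + 2)] G) (hC : ∀ ω, |G ω| ≤ C) :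
    μ[fun ω => G ω * (memInd (α ω) (k + 2) - hawkinsY (α ω) (k + 2)) | sieveSigma α (k + 2)]
      =ᵐ[μ] 0 := by
  have := h.isProb
  have hle := h.sieveSigma_le (k + 2)
  have hXm : Measurable fun ω => memInd (α ω) (k + 2) :=
    (h.measurable_memInd (Nat.lt_succ_self _)).mono (h.sieveSigma_le _) le_rfl
  have hYm := h.measurable_hawkinsY (k + 2)
  have hX : Integrable (fun ω => memInd (α ω) (k + 2)) μ :=
    Integrable.of_bound hXm.aestronglyMeasurable 1 (ae_of_all _ fun ω => by
      rw [Real.norm_of_nonneg (memInd_nonneg _ _)]; exact memInd_le_one _ _)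
  have hY : Integrable (fun ω => hawkinsY (α ω) (k + 2)) μ :=
    Integrable.of_bound (hYm.mono hle le_rfl).aestronglyMeasurable 1 (ae_of_all _ fun ω => by
      rw [Real.norm_of_nonneg (hawkinsY_nonneg (h.mem_ge_two ω) _)]
      exact hawkinsY_le_one (h.mem_ge_two ω) _)
  have h1 := condExp_stronglyMeasurable_mul_of_bound hle hG.stronglyMeasurable (hX.sub hY) C
    (ae_of_all _ hC)
  have h2 := condExp_sub hX hY (sieveSigma α (k + 2))
  have h3 := h.condExp_mem (k + 2) (by omega)
  have h4 : (Set.indicator {ω | k + 2 ∈ α ω} fun _ => (1 : ℝ)) =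
      fun ω => memInd (α ω) (k + 2) := by
    ext ω; simp [Set.indicator, memInd]
  rw [h4] at h3
  have h5 := condExp_of_stronglyMeasurable hle hYm.stronglyMeasurable hY
  filter_upwards [h1, h2, h3] with ω a b c
  refine Eq.trans a ?_
  rw [Pi.mul_apply, b, Pi.sub_apply, c, h5]
  simp

theorem IsHawkinsSieve.integral_difference (h : IsHawkinsSieve μ α)
    (hG : Measurable[sieveSigma α (k + 2)] G) (hC : ∀ ω, |G ω| ≤ C) :
    ∫ ω, G ω * (memInd (α ω) (k + 2) - hawkinsY (α ω) (k + 2)) ∂μ = 0 := by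
  have := h.isProb
  rw [← integral_condExp (h.sieveSigma_le (k + 2)),
    integral_congr_ae (h.condExp_difference hG hC)]
  simp

theorem IsHawkinsSieve.integrable_difference (h : IsHawkinsSieve μ α)
    (hG : Measurable[sieveSigma α (k + 2)] G) (hC : ∀ ω, |G ω| ≤ C) :
    Integrable (fun ω => G ω * (memInd (α ω) (k + 2) - hawkinsY (α ω) (k + 2))) μ := by
  have := h.isProb
  exact Integrable.of_bound ((h.measurable_difference hG).mono (h.sieveSigma_le _)
    le_rfl).aestronglyMeasurable C (ae_of_all _ (h.abs_difference_le hC))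

end Difference

theorem IsHawkinsSieve.ae_tendsto_sum_difference (h : IsHawkinsSieve μ α) {G : ℕ → Ω → ℝ}
    (hG : ∀ k, Measurable[sieveSigma α (k + 2)] (G k)) {C : ℕ → ℝ} (hC : ∀ k ω, |G k ω| ≤ C k)
    (hs : Summable fun k =>
      ∫ ω, (G k ω * (memInd (α ω) (k + 2) - hawkinsY (α ω) (k + 2))) ^ 2 ∂μ) :
    ∀ᵐ ω ∂μ, ∃ l, Tendsto (fun n => ∑ k ∈ range n,
      G k ω * (memInd (α ω) (k + 2) - hawkinsY (α ω) (k + 2))) atTop (nhds l) := by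
  have := h.isProb
  exact ae_tendsto_sum_of_martingale_difference h.filtration
    (fun k ω => G k ω * (memInd (α ω) (k + 2) - hawkinsY (α ω) (k + 2)))
    (fun k => (h.measurable_difference (hG k)).stronglyMeasurable) C
    (fun k => h.abs_difference_le (hC k)) (fun k => h.condExp_difference (hG k) (hC k)) hs

/-- Sums of differences with predictable weights in `[-1, 1]` are `o(n ^ (3 / 4))`. -/
theorem IsHawkinsSieve.ae_sum_difference_isLittleO (h : IsHawkinsSieve μ α) {G : ℕ → Ω → ℝ}
    (hG : ∀ k, Measurable[sieveSigma α (k + 2)] (G k)) (hC : ∀ k ω, |G k ω| ≤ 1) :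
    ∀ᵐ ω ∂μ, (fun n => ∑ k ∈ range n,
      G k ω * (memInd (α ω) (k + 2) - hawkinsY (α ω) (k + 2)))
        =o[atTop] fun n : ℕ => ((n : ℝ) + 1) ^ (3 / 4 : ℝ) := by
  have := h.isProb
  have hb : ∀ k : ℕ, 0 < ((k : ℝ) + 1) ^ (3 / 4 : ℝ) := fun k => by positivity
  have hC' : ∀ k ω, |G k ω / ((k : ℝ) + 1) ^ (3 / 4 : ℝ)| ≤ 1 / ((k : ℝ) + 1) ^ (3 / 4 : ℝ) :=
    fun k ω => by
      rw [abs_div, abs_of_pos (hb k)]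
      exact div_le_div_of_nonneg_right (hC k ω) (hb k).le
  have hsum : Summable fun k : ℕ => 1 / ((k : ℝ) + 1) ^ (3 / 2 : ℝ) := by
    have := (summable_nat_add_iff 1).2
      (Real.summable_one_div_nat_rpow.2 (by norm_num : (1 : ℝ) < 3 / 2))
    simpa using this
  have key := h.ae_tendsto_sum_difference
    (G := fun k ω => G k ω / ((k : ℝ) + 1) ^ (3 / 4 : ℝ)) (fun k => (hG k).div_const _) hC' <| by
      refine Summable.of_nonneg_of_le (fun k => integral_nonneg fun ω => sq_nonneg _)
        (fun k => ?_) hsum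
      have hsq : (1 / ((k : ℝ) + 1) ^ (3 / 4 : ℝ)) ^ 2 = 1 / ((k : ℝ) + 1) ^ (3 / 2 : ℝ) := by
        rw [div_pow, one_pow, ← Real.rpow_natCast, ← Real.rpow_mul (by positivity)]
        norm_num
      rw [← hsq]
      refine (integral_mono_of_nonneg (ae_of_all _ fun ω => sq_nonneg _)
        (integrable_const ((1 / ((k : ℝ) + 1) ^ (3 / 4 : ℝ)) ^ 2)) (ae_of_all _ fun ω => ?_)).trans
        (by simp)
      exact sq_le_sq' (abs_le.1 (h.abs_difference_le (hC' k) ω)).1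
        (abs_le.1 (h.abs_difference_le (hC' k) ω)).2
  filter_upwards [key] with ω ⟨l, hl⟩
  refine isLittleO_sum_range_of_tendsto_sum_div (fun m n hmn => by gcongr) hb ?_ (l := l) ?_
  · exact (tendsto_rpow_atTop (by norm_num)).comp
      (tendsto_atTop_add_const_right _ _ tendsto_natCast_atTop_atTop)
  · refine hl.congr fun n => Finset.sum_congr rfl fun k _ => ?_
    ring

theorem IsHawkinsSieve.integrable_inv_hawkinsY (h : IsHawkinsSieve μ α) (k : ℕ) :
    Integrable (fun ω => (hawkinsY (α ω) (k + 2))⁻¹) μ := by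
  have := h.isProb
  refine Integrable.of_bound (((h.measurable_hawkinsY (k + 2)).inv).mono (h.sieveSigma_le _)
    le_rfl).aestronglyMeasurable ((k : ℝ) + 1) (ae_of_all _ fun ω => ?_)
  rw [Real.norm_of_nonneg (inv_nonneg.2 (hawkinsY_nonneg (h.mem_ge_two ω) _))]
  exact inv_hawkinsY_le (h.mem_ge_two ω) k

theorem IsHawkinsSieve.abs_inv_hawkinsY_div_le (h : IsHawkinsSieve μ α) (k : ℕ) (ω : Ω) :
    |(hawkinsY (α ω) (k + 2))⁻¹ / ((k : ℝ) + 1)| ≤ 1 := by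
  have := hawkinsY_pos (h.mem_ge_two ω) k
  rw [abs_of_nonneg (by positivity), div_le_one (by positivity)]
  exact inv_hawkinsY_le (h.mem_ge_two ω) k

theorem IsHawkinsSieve.integral_inv_hawkinsY_le (h : IsHawkinsSieve μ α) (k : ℕ) :
    ∫ ω, (hawkinsY (α ω) (k + 2))⁻¹ ∂μ ≤ 4 * √((k : ℝ) + 1) := by
  have := h.isProb
  induction k with
  | zero => simp [hawkinsY_two (h.mem_ge_two _)]
  | succ k ih =>
    have hG : Measurable[sieveSigma α (k + 2)]
        fun ω => (hawkinsY (α ω) (k + 2))⁻¹ / ((k : ℝ) + 1) :=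
      (h.measurable_hawkinsY (k + 2)).inv.div_const _
    have hi : Integrable (fun ω => (hawkinsY (α ω) (k + 2))⁻¹ + 1 / ((k : ℝ) + 1)) μ :=
      (h.integrable_inv_hawkinsY k).add (integrable_const _)
    simp_rw [inv_hawkinsY_succ (h.mem_ge_two _)]
    rw [integral_add hi (h.integrable_difference hG (h.abs_inv_hawkinsY_div_le k)),
      integral_add (h.integrable_inv_hawkinsY k) (integrable_const _),
      h.integral_difference hG (h.abs_inv_hawkinsY_div_le k)]
    have hsq1 := Real.sq_sqrt (show (0 : ℝ) ≤ (k : ℝ) + 1 by positivity)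
    have hsq2 := Real.sq_sqrt (show (0 : ℝ) ≤ (k : ℝ) + 1 + 1 by positivity)
    have hk : (0 : ℝ) ≤ k := Nat.cast_nonneg k
    have hstep : 1 / ((k : ℝ) + 1) ≤ 4 * (√((k : ℝ) + 1 + 1) - √((k : ℝ) + 1)) := by
      have h1 : 1 ≤ √((k : ℝ) + 1) := Real.one_le_sqrt.2 (by linarith)
      have h2 : √((k : ℝ) + 1 + 1) ≤ 2 * √((k : ℝ) + 1) := by
        rw [Real.sqrt_le_left (by positivity)]; nlinarith
      set a := √((k : ℝ) + 1)
      set b := √((k : ℝ) + 1 + 1)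
      rw [div_le_iff₀ (by positivity), ← hsq1]
      have hba : (b - a) * (b + a) = 1 := by linear_combination hsq2 - hsq1
      have hb : 0 < b - a := by
        refine pos_of_mul_pos_left (hba ▸ one_pos) ?_
        positivity
      have : b + a ≤ 4 * a ^ 2 := by nlinarith
      nlinarith
    simp only [integral_const, probReal_univ, smul_eq_mul, one_mul, add_zero]
    push_cast
    linarith

theorem IsHawkinsSieve.ae_tendsto_inv_hawkinsY (h : IsHawkinsSieve μ α) :
    ∀ᵐ ω ∂μ, ∃ l, Tendsto (fun n : ℕ => (hawkinsY (α ω) (n + 2))⁻¹ - (harmonic n : ℝ))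
      atTop (nhds l) := by
  have := h.isProb
  have hG : ∀ k, Measurable[sieveSigma α (k + 2)]
      fun ω => (hawkinsY (α ω) (k + 2))⁻¹ / ((k : ℝ) + 1) := fun k =>
    (h.measurable_hawkinsY (k + 2)).inv.div_const _
  have hsum : Summable fun k : ℕ => 4 * (1 / ((k : ℝ) + 1) ^ (3 / 2 : ℝ)) := by
    have := (summable_nat_add_iff 1).2
      (Real.summable_one_div_nat_rpow.2 (by norm_num : (1 : ℝ) < 3 / 2))
    simpa using this.mul_left 4
  have key := h.ae_tendsto_sum_difference hG (C := fun _ => 1) h.abs_inv_hawkinsY_div_le <| by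
    refine Summable.of_nonneg_of_le (fun k => integral_nonneg fun ω => sq_nonneg _)
      (fun k => ?_) hsum
    have hG2 : Measurable[sieveSigma α (k + 2)] fun ω =>
        ((hawkinsY (α ω) (k + 2))⁻¹ / ((k : ℝ) + 1)) ^ 2 * (1 - 2 * hawkinsY (α ω) (k + 2)) :=
      ((hG k).pow_const 2).mul (measurable_const.sub ((h.measurable_hawkinsY (k + 2)).const_mul 2))
    have hC2 : ∀ ω, |((hawkinsY (α ω) (k + 2))⁻¹ / ((k : ℝ) + 1)) ^ 2
        * (1 - 2 * hawkinsY (α ω) (k + 2))| ≤ 1 := fun ω => by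
      rw [abs_mul, abs_pow]
      refine mul_le_one₀ (pow_le_one₀ (abs_nonneg _) (h.abs_inv_hawkinsY_div_le k ω))
        (abs_nonneg _) ?_
      have h1 := hawkinsY_nonneg (h.mem_ge_two ω) (k + 2)
      have h2 := hawkinsY_le_one (h.mem_ge_two ω) (k + 2)
      rw [abs_le]; constructor <;> linarith
    have e : ∀ ω, ((hawkinsY (α ω) (k + 2))⁻¹ / ((k : ℝ) + 1)
        * (memInd (α ω) (k + 2) - hawkinsY (α ω) (k + 2))) ^ 2
        = ((hawkinsY (α ω) (k + 2))⁻¹ / ((k : ℝ) + 1)) ^ 2 * (1 - 2 * hawkinsY (α ω) (k + 2))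
            * (memInd (α ω) (k + 2) - hawkinsY (α ω) (k + 2))
          + ((hawkinsY (α ω) (k + 2))⁻¹ - 1) / ((k : ℝ) + 1) ^ 2 := fun ω => by
      have hY := hawkinsY_pos (h.mem_ge_two ω) k
      have hX := memInd_sq (α ω) (k + 2)
      set Y := hawkinsY (α ω) (k + 2)
      set X := memInd (α ω) (k + 2)
      field_simp
      linear_combination hX
    have hi : Integrable (fun ω => ((hawkinsY (α ω) (k + 2))⁻¹ - 1) / ((k : ℝ) + 1) ^ 2) μ :=
      ((h.integrable_inv_hawkinsY k).sub (integrable_const 1)).div_const _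
    simp_rw [e]
    rw [integral_add (h.integrable_difference hG2 hC2) hi, h.integral_difference hG2 hC2,
      integral_div, integral_sub (h.integrable_inv_hawkinsY k) (integrable_const 1), zero_add]
    have hr : 4 * (1 / ((k : ℝ) + 1) ^ (3 / 2 : ℝ)) = 4 * √((k : ℝ) + 1) / ((k : ℝ) + 1) ^ 2 := by
      have hk : (0 : ℝ) < (k : ℝ) + 1 := by positivity
      rw [Real.sqrt_eq_rpow, ← Real.rpow_natCast _ 2, mul_div_assoc, ← Real.rpow_sub hk,
        one_div, ← Real.rpow_neg hk.le]
      norm_num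
    rw [hr]
    gcongr
    have := h.integral_inv_hawkinsY_le k
    simp only [integral_const, probReal_univ, smul_eq_mul, one_mul]
    linarith
  filter_upwards [key] with ω ⟨l, hl⟩
  refine ⟨l + 1, (hl.add_const 1).congr fun n => ?_⟩
  induction n with
  | zero => simp [hawkinsY_two (h.mem_ge_two ω)]
  | succ n ih =>
    rw [Finset.sum_range_succ, add_right_comm, ih, inv_hawkinsY_succ (h.mem_ge_two ω),
      harmonic_succ]
    push_cast
    ring

theorem IsHawkinsSieve.ae_hawkinsY_isEquivalent (h : IsHawkinsSieve μ α) :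
    ∀ᵐ ω ∂μ, (fun n => hawkinsY (α ω) n) ~[atTop] fun n : ℕ => (Real.log n)⁻¹ := by
  filter_upwards [h.ae_tendsto_inv_hawkinsY] with ω ⟨l, hl⟩
  have hlog : Tendsto (fun n : ℕ => Real.log (n + 2 : ℕ)) atTop atTop :=
    tendsto_log_natCast_atTop.comp (tendsto_add_atTop_nat 2)
  have h1 : Tendsto (fun n : ℕ => (harmonic (n + 2) : ℝ) - Real.log (n + 2 : ℕ)) atTop
      (nhds Real.eulerMascheroniConstant) :=
    Real.tendsto_harmonic_sub_log.comp (tendsto_add_atTop_nat 2)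
  have h2 : Tendsto (fun n : ℕ => (harmonic (n + 2) : ℝ) - harmonic n) atTop (nhds (0 + 0)) := by
    have a := tendsto_one_div_add_atTop_nhds_zero_nat (𝕜 := ℝ)
    have b := a.comp (tendsto_add_atTop_nat 1)
    refine (a.add b).congr fun n => ?_
    simp only [harmonic_succ, Function.comp]
    push_cast
    ring
  have h3 : Tendsto (fun n : ℕ => (hawkinsY (α ω) (n + 2))⁻¹ - Real.log (n + 2 : ℕ)) atTop
      (nhds (l - (0 + 0) + Real.eulerMascheroniConstant)) :=
    ((hl.sub h2).add h1).congr fun n => by ring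
  have h4 : (fun n : ℕ => (hawkinsY (α ω) (n + 2))⁻¹) ~[atTop]
      fun n : ℕ => Real.log (n + 2 : ℕ) :=
    (h3.isBigO_one ℝ).trans_isLittleO
      (isLittleO_const_left.2 (Or.inr (tendsto_norm_atTop_atTop.comp hlog)))
  have h5 : (fun n : ℕ => hawkinsY (α ω) (n + 2)) ~[atTop]
      fun n : ℕ => (Real.log (n + 2 : ℕ))⁻¹ := by
    have := h4.inv
    simp only [Pi.inv_def, inv_inv] at this
    exact this
  unfold IsEquivalent at h5 ⊢
  rw [← map_add_atTop_eq_nat 2]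
  exact isLittleO_map.2 h5

end HawkinsSieve

theorem cast_piTwin (A : Set ℕ) (k x : ℕ) :
    (piTwin A k x : ℝ) = ∑ m ∈ range (x + 1), memInd A m * memInd A (m + k) := by
  unfold piTwin memInd
  rw [Finset.card_filter]
  push_cast
  refine Finset.sum_congr rfl fun m _ => ?_
  by_cases h1 : m ∈ A <;> by_cases h2 : m + k ∈ A <;> simp [h1, h2]

/-- A set with the prime-number-theorem density of the sieve and cancellation in
the relevant sums of differences satisfies the twin prime asymptotics. -/
theorem piTwin_two_isEquivalent {A : Set ℕ} (hA : ∀ n ∈ A, 2 ≤ n)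
    (hY : (fun n => hawkinsY A n) ~[atTop] fun n : ℕ => (Real.log n)⁻¹)
    (h1 : (fun n => ∑ k ∈ range n, memInd A k * (memInd A (k + 2) - hawkinsY A (k + 2)))
      =o[atTop] fun n : ℕ => ((n : ℝ) + 1) ^ (3 / 4 : ℝ))
    (h2 : (fun n => ∑ k ∈ range n,
        hawkinsY A (k + 2) * (memInd A (k + 2) - hawkinsY A (k + 2)))
      =o[atTop] fun n : ℕ => ((n : ℝ) + 1) ^ (3 / 4 : ℝ)) :
    (fun x => (piTwin A 2 x : ℝ)) ~[atTop] fun x : ℕ => (x : ℝ) / Real.log x ^ 2 := by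
  refine IsEquivalent.trans ?_ div_log_sq_isEquivalent_sum.symm
  set L : ℕ → ℝ := fun n => ∑ k ∈ range n, 1 / Real.log (k : ℝ) ^ 2 with hL
  have hbdd : ∀ (f : ℕ → ℝ) (c : ℝ), (∀ n, |f n| ≤ c) → f =o[atTop] L := fun f c hf => by
    have : f =O[atTop] fun _ => (1 : ℝ) := IsBigO.of_bound c (.of_forall fun n => by
      simpa using hf n)
    exact this.trans_isLittleO (isLittleO_const_left.2
      (Or.inr (tendsto_norm_atTop_atTop.comp tendsto_sum_one_div_log_sq)))
  have hX0 := memInd_nonneg A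
  have hX1 := memInd_le_one A
  have hY0 := hawkinsY_nonneg hA
  have hY1 := hawkinsY_le_one hA
  have e1 := h1.trans rpow_isLittleO_sum_one_div_log_sq
  have e2 : (fun n => ∑ k ∈ range n, memInd A k * (hawkinsY A (k + 2) - hawkinsY A k))
      =o[atTop] L := by
    refine IsLittleO.sum_range ?_ (fun n => by positivity) tendsto_sum_one_div_log_sq
    refine IsBigO.trans_isLittleO (IsBigO.of_bound 2 ?_) one_div_natCast_isLittleO_one_div_log_sq
    filter_upwards [eventually_ge_atTop 1] with n hn
    have hn' : (0 : ℝ) < n := by exact_mod_cast hn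
    have a := abs_hawkinsY_succ_sub_le hA n
    have b := abs_hawkinsY_succ_sub_le hA (n + 1)
    have c : (1 : ℝ) / (n + 1 : ℕ) ≤ 1 / n := by push_cast; gcongr; linarith
    rw [norm_mul, Real.norm_of_nonneg (hX0 n), Real.norm_eq_abs,
      Real.norm_of_nonneg (by positivity : (0 : ℝ) ≤ 1 / n)]
    have d := abs_sub_le (hawkinsY A (n + 1 + 1)) (hawkinsY A (n + 1)) (hawkinsY A n)
    calc memInd A n * |hawkinsY A (n + 2) - hawkinsY A n|
        ≤ 1 * |hawkinsY A (n + 2) - hawkinsY A n| := by gcongr; exact hX1 n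
      _ ≤ 2 * (1 / n) := by rw [one_mul]; exact d.trans (by linarith)
  have e3 : (fun n => ∑ k ∈ range n, hawkinsY A k * (memInd A k - hawkinsY A k))
      =o[atTop] L := by
    set c : ℕ → ℝ := fun k => hawkinsY A k * (memInd A k - hawkinsY A k) with hc
    have hcb : ∀ k, |c k| ≤ 1 := fun k => by
      rw [hc, abs_le]
      constructor <;> nlinarith [hX0 k, hX1 k, hY0 k, hY1 k]
    have hshift : ∀ n, ∑ k ∈ range n, c k
        = ∑ k ∈ range n, c (k + 2) + (c 0 + c 1 - c n - c (n + 1)) := fun n => by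
      induction n with
      | zero => simp
      | succ n ih => rw [Finset.sum_range_succ, ih, Finset.sum_range_succ]; ring
    simp_rw [hshift]
    refine (h2.trans rpow_isLittleO_sum_one_div_log_sq).add (hbdd _ 4 fun n => ?_)
    have := abs_le.1 (hcb 0)
    have := abs_le.1 (hcb 1)
    have := abs_le.1 (hcb n)
    have := abs_le.1 (hcb (n + 1))
    rw [abs_le]
    constructor <;> linarith
  have e4 : (fun n => ∑ k ∈ range n, (hawkinsY A k ^ 2 - 1 / Real.log (k : ℝ) ^ 2))
      =o[atTop] L := by
    refine IsLittleO.sum_range ?_ (fun n => by positivity) tendsto_sum_one_div_log_sq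
    have := (hY.pow 2).isLittleO
    simpa [Pi.sub_def, Pi.pow_def] using this
  have e5 : (fun n => memInd A n * memInd A (n + 2)) =o[atTop] L := hbdd _ 1 fun n => by
    rw [abs_of_nonneg (mul_nonneg (hX0 _) (hX0 _))]
    exact mul_le_one₀ (hX1 _) (hX0 _) (hX1 _)
  refine ((((e1.add e2).add e3).add e4).add e5).congr_left fun n => ?_
  simp only [Pi.sub_apply, cast_piTwin, Finset.sum_range_succ _ n, hL, ← Finset.sum_add_distrib]
  rw [add_sub_right_comm, ← Finset.sum_sub_distrib]
  congr 1
  exact Finset.sum_congr rfl fun k _ => by ring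

theorem twin_primes_hawkins_two {Ω : Type*} [MeasurableSpace Ω] (μ : Measure Ω)
    (α : Ω → Set ℕ) (h : IsHawkinsSieve μ α) :
    ∀ᵐ ω ∂μ, Tendsto
      (fun x : ℕ => (piTwin (α ω) 2 x : ℝ) / ((x : ℝ) / (Real.log x) ^ 2))
      atTop (nhds 1) := by
  have h1 := h.ae_sum_difference_isLittleO (G := fun k ω => memInd (α ω) k)
    (fun k => h.measurable_memInd (by omega)) fun k ω => by
      rw [abs_of_nonneg (memInd_nonneg _ _)]; exact memInd_le_one _ _
  have h2 := h.ae_sum_difference_isLittleO (G := fun k ω => hawkinsY (α ω) (k + 2))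
    (fun k => h.measurable_hawkinsY (k + 2)) fun k ω => by
      rw [abs_of_nonneg (hawkinsY_nonneg (h.mem_ge_two ω) _)]
      exact hawkinsY_le_one (h.mem_ge_two ω) _
  filter_upwards [h.ae_hawkinsY_isEquivalent, h1, h2] with ω hY a b
  refine (isEquivalent_iff_tendsto_one ?_).1 (piTwin_two_isEquivalent (h.mem_ge_two ω) hY a b)
  filter_upwards [eventually_ge_atTop 2] with n hn
  have h2 : (2 : ℝ) ≤ n := by exact_mod_cast hn
  have := Real.log_pos (show (1 : ℝ) < n by linarith)
  positivity
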